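/- arXiv:2103.14478 — 4 statements merged into one kernel-verified Lean document; each statement's English description precedes it below -/
import Mathlib

section
/- Let S be a semigroup, ω a weight on S, and s ∈ S. Then the sequences (ω(sⁿ)^{1/n})_{n≥1} and (ω̃₁(sⁿ)^{1/n})_{n≥1} both converge (to their respective infima, by submultiplicativity), and their limits are equal: lim_{n→∞} ω(sⁿ)^{1/n} = lim_{n→∞} ω̃₁(sⁿ)^{1/n}. -/
/-- A weight on a semigroup `S`: strictly positive and submultiplicative. -/
def IsWeight {S : Type*} [Semigroup S] (ω : S → ℝ) : Prop :=
  (∀ s, 0 < ω s) ∧ ∀ s t, ω (s * t) ≤ ω s * ω t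

/-- `wt ω s = ω̃₁(s) = sup_{t ∈ S} ω(st)/ω(t)`. -/
noncomputable def wt {S : Type*} [Semigroup S] (ω : S → ℝ) (s : S) : ℝ :=
  ⨆ t : S, ω (s * t) / ω t

/-- Powers in a semigroup: `spow s n = s^(n+1)`. -/
def spow {S : Type*} [Semigroup S] (s : S) : ℕ → S
  | 0 => s
  | n + 1 => spow s n * s

theorem spow_add {S : Type*} [Semigroup S] (s : S) (m n : ℕ) :
    spow s (m + n + 1) = spow s m * spow s n := by
  induction n with
  | zero => rfl
  | succ n ih =>
    change spow s (m + n + 1) * s = spow s m * (spow s n * s)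
    rw [ih, mul_assoc]

namespace IsWeight

variable {S : Type*} [Semigroup S] {ω : S → ℝ}

theorem div_le (hω : IsWeight ω) (s t : S) : ω (s * t) / ω t ≤ ω s :=
  (div_le_iff₀ (hω.1 t)).2 (hω.2 s t)

theorem div_le_wt (hω : IsWeight ω) (s t : S) : ω (s * t) / ω t ≤ wt ω s :=
  le_ciSup (f := fun t => ω (s * t) / ω t) ⟨ω s, by rintro _ ⟨t, rfl⟩; exact hω.div_le s t⟩ t

theorem wt_le (hω : IsWeight ω) (s : S) : wt ω s ≤ ω s :=
  have : Nonempty S := ⟨s⟩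
  ciSup_le (hω.div_le s)

theorem isWeight_wt (hω : IsWeight ω) : IsWeight (wt ω) := by
  have hpos (s : S) : 0 < wt ω s :=
    (div_pos (hω.1 (s * s)) (hω.1 s)).trans_le (hω.div_le_wt s s)
  refine ⟨hpos, fun s t => ?_⟩
  have : Nonempty S := ⟨s⟩
  refine ciSup_le fun r => ?_
  calc ω (s * t * r) / ω r
      = ω (s * (t * r)) / ω (t * r) * (ω (t * r) / ω r) := by
        rw [mul_assoc, div_mul_div_cancel₀ (hω.1 _).ne']
    _ ≤ wt ω s * wt ω t :=
        mul_le_mul (hω.div_le_wt s _) (hω.div_le_wt t r)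
          (div_pos (hω.1 _) (hω.1 _)).le (hpos s).le

end IsWeight

theorem bddBelow_range_rpow {a : ℕ → ℝ} (ha : ∀ n, 0 < a n) :
    BddBelow (Set.range fun n : ℕ => a n ^ ((1 : ℝ) / ((n : ℝ) + 1))) :=
  ⟨0, by rintro _ ⟨n, rfl⟩; exact Real.rpow_nonneg (ha n).le _⟩

/-- Fekete's lemma for positive submultiplicative sequences, with indices shifted by one. -/
theorem tendsto_rpow_iInf_of_submultiplicative {a : ℕ → ℝ} (ha : ∀ n, 0 < a n)
    (hmul : ∀ m n, a (m + n + 1) ≤ a m * a n) :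
    Filter.Tendsto (fun n : ℕ => a n ^ ((1 : ℝ) / ((n : ℝ) + 1)))
      Filter.atTop (nhds (⨅ n : ℕ, a n ^ ((1 : ℝ) / ((n : ℝ) + 1)))) := by
  let u : ℕ → ℝ := fun n => Nat.casesOn n 0 fun k => Real.log (a k)
  have hu : Subadditive u := by
    rintro (_ | m) (_ | n)
    · simp [u]
    · simp [u]
    · simp [u]
    · rw [show m + 1 + (n + 1) = m + n + 1 + 1 by omega]
      change Real.log (a (m + n + 1)) ≤ Real.log (a m) + Real.log (a n)
      rw [← Real.log_mul (ha m).ne' (ha n).ne']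
      exact Real.log_le_log (ha _) (hmul m n)
  have hlt {L : ℝ} (hL : 0 < L) (n : ℕ) :
      a n ^ ((1 : ℝ) / ((n : ℝ) + 1)) < L ↔ u (n + 1) / ((n + 1 : ℕ) : ℝ) < Real.log L := by
    rw [← Real.log_lt_log_iff (Real.rpow_pos_of_pos (ha n) _) hL, Real.log_rpow (ha n)]
    push_cast
    rw [one_div_mul_eq_div]
  refine tendsto_order.2 ⟨fun L hL => .of_forall fun n =>
    hL.trans_le (ciInf_le (bddBelow_range_rpow ha) n), fun L hL => ?_⟩
  obtain ⟨n, hn⟩ := exists_lt_of_ciInf_lt hL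
  have hLpos : 0 < L := (Real.rpow_pos_of_pos (ha n) _).trans hn
  have hev := hu.eventually_div_lt_of_div_lt n.succ_ne_zero ((hlt hLpos n).1 hn)
  filter_upwards [(Filter.tendsto_add_atTop_nat 1).eventually hev] with p hp
  exact (hlt hLpos p).2 hp

theorem tendsto_const_rpow_one_div {c : ℝ} (hc : 0 < c) :
    Filter.Tendsto (fun n : ℕ => c ^ ((1 : ℝ) / ((n : ℝ) + 1))) Filter.atTop (nhds 1) := by
  simpa [Function.comp_def] using (Real.continuousAt_const_rpow hc.ne').tendsto.comp
    (tendsto_one_div_add_atTop_nhds_zero_nat (𝕜 := ℝ))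

theorem stmt4 {S : Type*} [Semigroup S] (ω : S → ℝ) (hω : IsWeight ω) (s : S) :
    Filter.Tendsto (fun n : ℕ => ω (spow s n) ^ ((1 : ℝ) / ((n : ℝ) + 1)))
      Filter.atTop (nhds (⨅ n : ℕ, ω (spow s n) ^ ((1 : ℝ) / ((n : ℝ) + 1)))) ∧
    Filter.Tendsto (fun n : ℕ => wt ω (spow s n) ^ ((1 : ℝ) / ((n : ℝ) + 1)))
      Filter.atTop (nhds (⨅ n : ℕ, wt ω (spow s n) ^ ((1 : ℝ) / ((n : ℝ) + 1)))) ∧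
    (⨅ n : ℕ, ω (spow s n) ^ ((1 : ℝ) / ((n : ℝ) + 1))) =
      ⨅ n : ℕ, wt ω (spow s n) ^ ((1 : ℝ) / ((n : ℝ) + 1)) := by
  have hω' := hω.isWeight_wt
  have htend {η : S → ℝ} (hη : IsWeight η) :=
    tendsto_rpow_iInf_of_submultiplicative (a := fun n => η (spow s n)) (fun n => hη.1 _)
      fun m n => by simpa only [spow_add] using hη.2 (spow s m) (spow s n)
  refine ⟨htend hω, htend hω', le_antisymm ?_ ?_⟩
  · set A := ⨅ n : ℕ, ω (spow s n) ^ ((1 : ℝ) / ((n : ℝ) + 1))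
    have hA0 : 0 ≤ A := Real.iInf_nonneg fun n => Real.rpow_nonneg (hω.1 _).le _
    rcases hA0.eq_or_lt with h0 | hpos
    · rw [← h0]
      exact Real.iInf_nonneg fun n => Real.rpow_nonneg (hω'.1 _).le _
    have hl := (tendsto_const_rpow_one_div hpos).const_mul A
    have hr := (htend hω').mul (tendsto_const_rpow_one_div (hω.1 s))
    rw [mul_one] at hl hr
    refine le_of_tendsto_of_tendsto' hl hr fun n => ?_
    have hroot : A ≤ ω (spow s (n + 1)) ^ ((1 : ℝ) / (((n + 1 : ℕ) : ℝ) + 1)) :=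
      ciInf_le (bddBelow_range_rpow fun n => hω.1 (spow s n)) (n + 1)
    have hpow : A ^ (n + 1) * A ≤ wt ω (spow s n) * ω s := by
      calc A ^ (n + 1) * A = A ^ (n + 1 + 1) := (pow_succ _ _).symm
        _ ≤ (ω (spow s (n + 1)) ^ ((1 : ℝ) / (((n + 1 : ℕ) : ℝ) + 1))) ^ (n + 1 + 1) := by
          gcongr
        _ = ω (spow s (n + 1)) := by
          rw [← Nat.cast_add_one, one_div, Real.rpow_inv_natCast_pow (hω.1 _).le (by omega)]
        _ ≤ wt ω (spow s n) * ω s := (div_le_iff₀ (hω.1 s)).1 (hω.div_le_wt (spow s n) s)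
    calc A * A ^ ((1 : ℝ) / ((n : ℝ) + 1))
        = (A ^ (n + 1) * A) ^ ((1 : ℝ) / ((n : ℝ) + 1)) := by
          rw [Real.mul_rpow (by positivity) hA0, ← Nat.cast_add_one, one_div,
            Real.pow_rpow_inv_natCast hA0 (by omega)]
      _ ≤ (wt ω (spow s n) * ω s) ^ ((1 : ℝ) / ((n : ℝ) + 1)) :=
          Real.rpow_le_rpow (by positivity) hpow (by positivity)
      _ = _ := Real.mul_rpow (hω'.1 _).le (hω.1 _).le
  · exact ciInf_mono (bddBelow_range_rpow fun n => hω'.1 _) fun n =>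
      Real.rpow_le_rpow (hω'.1 _).le (hω.wt_le _) (by positivity)
end

section
/- Let S be a right cancellative semigroup, ω a weight on S, and t ∈ S. Then ‖δ_t‖_{ω op} = ω̃₁(t); that is, sup{ ‖δ_t * g‖_ω : g ∈ ℓ¹(S, ω), ‖g‖_ω ≤ 1 } = ω̃₁(t). -/
open scoped Classical in
/-- Convolution: `(f * g)(s) = Σ_{(u,v), uv = s} f(u) g(v)`. -/
noncomputable def conv {S : Type*} [Semigroup S] (f g : S → ℂ) (s : S) : ℂ :=
  ∑' p : S × S, if p.1 * p.2 = s then f p.1 * g p.2 else 0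

/-- The weighted norm `‖f‖_ω = Σ_s |f(s)| ω(s)`. -/
noncomputable def wnorm {S : Type*} (ω : S → ℝ) (f : S → ℂ) : ℝ :=
  ∑' s, ‖f s‖ * ω s

/-- The operator norm `‖f‖_{ω op} = sup { ‖f * g‖_ω : g ∈ ℓ¹(S,ω), ‖g‖_ω ≤ 1 }`. -/
noncomputable def opW {S : Type*} [Semigroup S] (ω : S → ℝ) (f : S → ℂ) : ℝ :=
  sSup {r : ℝ | ∃ g : S → ℂ,
    (Summable fun s => ‖g s‖ * ω s) ∧ wnorm ω g ≤ 1 ∧ r = wnorm ω (conv f g)}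

/-- `S` is right cancellative: `xs = ys` implies `x = y`. -/
def RightCancellative (S : Type*) [Semigroup S] : Prop :=
  ∀ x y s : S, x * s = y * s → x = y

/-- The F-property of a weight `ω`. -/
def FProp {S : Type*} [Semigroup S] (ω : S → ℝ) : Prop :=
  ∀ (T : Finset S) (r : ℝ), 0 < r → r < 1 →
    ∃ s : S, ∀ t ∈ T, r * wt ω t ≤ ω (t * s) / ω s

open scoped Classical in
theorem hasSum_norm_delta_mul {S : Type*} (ω : S → ℝ) (u : S) (c : ℂ) :
    HasSum (fun s => ‖if s = u then c else 0‖ * ω s) (‖c‖ * ω u) := by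
  convert hasSum_single u ?_ using 1
  · simp
  · intro v hv
    simp [hv]

section WeightedConvolution

variable {S : Type*} [Semigroup S]

theorem IsWeight.bddAbove_range_div {ω : S → ℝ} (hω : IsWeight ω) (t : S) :
    BddAbove (Set.range fun u : S => ω (t * u) / ω u) := by
  refine ⟨ω t, ?_⟩
  rintro _ ⟨u, rfl⟩
  exact (div_le_iff₀ (hω.1 u)).2 (hω.2 t u)

theorem IsWeight.apply_mul_le {ω : S → ℝ} (hω : IsWeight ω) (t u : S) :
    ω (t * u) ≤ wt ω t * ω u :=
  (div_le_iff₀ (hω.1 u)).1 (le_ciSup (hω.bddAbove_range_div t) u)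

open scoped Classical in
theorem conv_delta (t : S) (g : S → ℂ) (s : S) :
    conv (fun x => if x = t then 1 else 0) g s = ∑' v : (t * ·) ⁻¹' {s}, g v := by
  have hinj : Function.Injective fun v : S => (t, v) := Prod.mk_right_injective t
  rw [conv, ← hinj.tsum_eq, tsum_subtype]
  · refine tsum_congr fun v => ?_
    simp [Set.indicator_apply]
  · rintro ⟨u, v⟩ h
    by_cases hu : u = t
    · exact ⟨v, by rw [hu]⟩
    · simp [hu] at h

open scoped Classical in
theorem conv_delta_delta (t u : S) (c : ℂ) :
    conv (fun x => if x = t then 1 else 0) (fun x => if x = u then c else 0) =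
      fun s => if s = t * u then c else 0 := by
  funext s
  rw [conv_delta, tsum_subtype _ fun v => if v = u then c else 0, tsum_eq_single u]
  · simp [Set.indicator_apply, eq_comm]
  · intro v hv
    simp [Set.indicator_apply, hv]

open scoped Classical in
theorem IsWeight.wnorm_conv_delta_le {ω : S → ℝ} (hω : IsWeight ω) (t : S) {g : S → ℂ}
    (hg : Summable fun s => ‖g s‖ * ω s) :
    wnorm ω (conv (fun x => if x = t then 1 else 0) g) ≤ wt ω t * wnorm ω g := by
  have hle : ∀ v, ‖g v‖ * ω (t * v) ≤ wt ω t * (‖g v‖ * ω v) := fun v => by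
    have := mul_le_mul_of_nonneg_left (hω.apply_mul_le t v) (norm_nonneg (g v))
    linarith
  have hF : Summable fun v => ‖g v‖ * ω (t * v) :=
    (hg.mul_left (wt ω t)).of_nonneg_of_le
      (fun v => mul_nonneg (norm_nonneg _) (hω.1 _).le) hle
  have hfib := hF.hasSum.tsum_fiberwise (t * ·)
  have hpt : ∀ s, ‖conv (fun x => if x = t then 1 else 0) g s‖ * ω s ≤
      ∑' v : (t * ·) ⁻¹' {s}, ‖g v‖ * ω (t * v) := fun s => by
    have hcongr : (fun v : (t * ·) ⁻¹' {s} => ‖g v‖ * ω (t * v)) =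
        fun v : (t * ·) ⁻¹' {s} => ‖g v‖ * ω s := by
      funext v
      rw [show t * (v : S) = s from v.2]
    have hsum : Summable fun v : (t * ·) ⁻¹' {s} => ‖g v‖ := by
      have h := hF.subtype ((t * ·) ⁻¹' {s})
      change Summable (fun v : (t * ·) ⁻¹' {s} => ‖g v‖ * ω (t * v)) at h
      rw [hcongr] at h
      exact (summable_mul_right_iff (hω.1 s).ne').1 h
    rw [hcongr, tsum_mul_right, conv_delta]
    exact mul_le_mul_of_nonneg_right (norm_tsum_le_tsum_norm hsum) (hω.1 s).le
  calc wnorm ω (conv (fun x => if x = t then 1 else 0) g)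
      ≤ ∑' s, ∑' v : (t * ·) ⁻¹' {s}, ‖g v‖ * ω (t * v) :=
        (hfib.summable.of_nonneg_of_le
          (fun s => mul_nonneg (norm_nonneg _) (hω.1 s).le) hpt).tsum_le_tsum hpt hfib.summable
    _ = ∑' v, ‖g v‖ * ω (t * v) := hfib.tsum_eq
    _ ≤ ∑' v, wt ω t * (‖g v‖ * ω v) := hF.tsum_le_tsum hle (hg.mul_left _)
    _ = wt ω t * wnorm ω g := tsum_mul_left

end WeightedConvolution

open scoped Classical in
theorem stmt6 {S : Type*} [Semigroup S] (hS : RightCancellative S)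
    (ω : S → ℝ) (hω : IsWeight ω) (t : S) :
    opW ω (fun s => if s = t then 1 else 0) = wt ω t := by
  have hwt : 0 ≤ wt ω t := Real.iSup_nonneg fun u => (div_pos (hω.1 _) (hω.1 u)).le
  have hub : ∀ r ∈ {r : ℝ | ∃ g : S → ℂ, (Summable fun s => ‖g s‖ * ω s) ∧ wnorm ω g ≤ 1 ∧
      r = wnorm ω (conv (fun s => if s = t then 1 else 0) g)}, r ≤ wt ω t := by
    rintro r ⟨g, hg, hg1, rfl⟩
    exact (hω.wnorm_conv_delta_le t hg).trans (mul_le_of_le_one_right hwt hg1)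
  have : Nonempty S := ⟨t⟩
  refine le_antisymm (csSup_le ?_ hub) (ciSup_le fun u => le_csSup ⟨_, hub⟩ ?_)
  · exact ⟨_, 0, by simp, by simp [wnorm], rfl⟩
  · have hu := hω.1 u
    have hnorm : ‖((ω u)⁻¹ : ℂ)‖ = (ω u)⁻¹ := by
      rw [norm_inv, Complex.norm_real, Real.norm_of_nonneg hu.le]
    refine ⟨fun s => if s = u then ((ω u)⁻¹ : ℂ) else 0,
      (hasSum_norm_delta_mul ω u _).summable, ?_, ?_⟩
    · rw [wnorm, (hasSum_norm_delta_mul ω u _).tsum_eq, hnorm, inv_mul_cancel₀ hu.ne']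
    · rw [conv_delta_delta, wnorm, (hasSum_norm_delta_mul ω (t * u) _).tsum_eq, hnorm,
        div_eq_inv_mul]
end

section
/- Let S be a right cancellative semigroup and ω a weight on S. Then for every f ∈ ℓ¹(S, ω), ‖f‖_{ω op} ≤ ‖f‖_{ω̃₁}; that is, sup{ ‖f * g‖_ω : g ∈ ℓ¹(S, ω), ‖g‖_ω ≤ 1 } ≤ Σ_{s∈S} |f(s)| ω̃₁(s). -/
theorem bddAbove_range_weight_ratio {S : Type*} [Semigroup S] {ω : S → ℝ} (hω : IsWeight ω)
    (s : S) : BddAbove (Set.range fun t : S => ω (s * t) / ω t) := by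
  refine ⟨ω s, ?_⟩
  rintro _ ⟨t, rfl⟩
  exact (div_le_iff₀ (hω.1 t)).2 (hω.2 s t)

theorem wt_nonneg {S : Type*} [Semigroup S] {ω : S → ℝ} (hω : IsWeight ω) (s : S) :
    0 ≤ wt ω s :=
  Real.iSup_nonneg fun t => (div_pos (hω.1 _) (hω.1 t)).le

theorem wt_le {S : Type*} [Semigroup S] {ω : S → ℝ} (hω : IsWeight ω) (s : S) :
    wt ω s ≤ ω s :=
  Real.iSup_le (fun t => (div_le_iff₀ (hω.1 t)).2 (hω.2 s t)) (hω.1 s).le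

theorem weight_mul_le_wt_mul {S : Type*} [Semigroup S] {ω : S → ℝ} (hω : IsWeight ω) (s t : S) :
    ω (s * t) ≤ wt ω s * ω t :=
  (div_le_iff₀ (hω.1 t)).1 (le_ciSup (bddAbove_range_weight_ratio hω s) t)

open scoped Classical in
theorem norm_conv_mul_weight_le {S : Type*} [Semigroup S] {ω : S → ℝ} (hω : IsWeight ω)
    {f g : S → ℂ} (hF : Summable fun p : S × S => ‖f p.1‖ * ‖g p.2‖ * ω (p.1 * p.2)) (s : S) :
    ‖conv f g s‖ * ω s ≤
      ∑' p : S × S, if p.1 * p.2 = s then ‖f p.1‖ * ‖g p.2‖ * ω (p.1 * p.2) else 0 := by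
  have heq : ∀ p : S × S, ‖if p.1 * p.2 = s then f p.1 * g p.2 else 0‖ * ω s =
      if p.1 * p.2 = s then ‖f p.1‖ * ‖g p.2‖ * ω (p.1 * p.2) else 0 := by
    intro p
    split_ifs with h
    · rw [norm_mul, h]
    · simp
  have hsum : Summable fun p : S × S => ‖if p.1 * p.2 = s then f p.1 * g p.2 else 0‖ := by
    rw [← summable_mul_right_iff (hω.1 s).ne']
    simp only [heq]
    exact hF.indicator {p : S × S | p.1 * p.2 = s}
  calc ‖conv f g s‖ * ω s
      ≤ (∑' p : S × S, ‖if p.1 * p.2 = s then f p.1 * g p.2 else 0‖) * ω s :=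
        mul_le_mul_of_nonneg_right (norm_tsum_le_tsum_norm hsum) (hω.1 s).le
    _ = _ := by rw [← tsum_mul_right]; exact tsum_congr heq

open scoped Classical in
theorem wnorm_conv_le {S : Type*} [Semigroup S] {ω : S → ℝ} (hω : IsWeight ω) {f g : S → ℂ}
    (hf : Summable fun s => ‖f s‖ * ω s) (hg : Summable fun s => ‖g s‖ * ω s) :
    wnorm ω (conv f g) ≤ wnorm (wt ω) f * wnorm ω g := by
  have hf' : Summable fun s => ‖f s‖ * wt ω s :=
    hf.of_nonneg_of_le (fun s => mul_nonneg (norm_nonneg _) (wt_nonneg hω s))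
      fun s => mul_le_mul_of_nonneg_left (wt_le hω s) (norm_nonneg _)
  have hP := hf'.mul_of_nonneg hg (fun s => mul_nonneg (norm_nonneg _) (wt_nonneg hω s))
    fun s => mul_nonneg (norm_nonneg _) (hω.1 s).le
  have hF0 : ∀ p : S × S, 0 ≤ ‖f p.1‖ * ‖g p.2‖ * ω (p.1 * p.2) := fun p =>
    mul_nonneg (by positivity) (hω.1 _).le
  have hFle : ∀ p : S × S, ‖f p.1‖ * ‖g p.2‖ * ω (p.1 * p.2) ≤
      ‖f p.1‖ * wt ω p.1 * (‖g p.2‖ * ω p.2) := fun p => by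
    rw [mul_mul_mul_comm]
    exact mul_le_mul_of_nonneg_left (weight_mul_le_wt_mul hω _ _) (by positivity)
  have hF := hP.of_nonneg_of_le hF0 hFle
  have hmul : wnorm (wt ω) f * wnorm ω g =
      ∑' p : S × S, ‖f p.1‖ * wt ω p.1 * (‖g p.2‖ * ω p.2) := hf'.tsum_mul_tsum hg hP
  rw [hmul]
  refine Real.tsum_le_of_sum_le (fun s => mul_nonneg (norm_nonneg _) (hω.1 s).le) fun T => ?_
  have hind : ∀ s ∈ T, Summable fun p : S × S =>
      if p.1 * p.2 = s then ‖f p.1‖ * ‖g p.2‖ * ω (p.1 * p.2) else 0 := fun s _ =>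
    hF.indicator {p : S × S | p.1 * p.2 = s}
  calc ∑ s ∈ T, ‖conv f g s‖ * ω s
      ≤ ∑ s ∈ T, ∑' p : S × S,
          if p.1 * p.2 = s then ‖f p.1‖ * ‖g p.2‖ * ω (p.1 * p.2) else 0 :=
        Finset.sum_le_sum fun s _ => norm_conv_mul_weight_le hω hF s
    _ = ∑' p : S × S, ∑ s ∈ T,
          if p.1 * p.2 = s then ‖f p.1‖ * ‖g p.2‖ * ω (p.1 * p.2) else 0 :=
        (Summable.tsum_finsetSum hind).symm
    _ ≤ _ := by
        refine (summable_sum hind).tsum_le_tsum (fun p => ?_) hP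
        rw [Finset.sum_ite_eq]
        split_ifs
        · exact hFle p
        · exact (hF0 p).trans (hFle p)

theorem stmt7 {S : Type*} [Semigroup S] (hS : RightCancellative S)
    (ω : S → ℝ) (hω : IsWeight ω)
    (f : S → ℂ) (hf : Summable fun s => ‖f s‖ * ω s) :
    opW ω f ≤ wnorm (wt ω) f := by
  have h0 : 0 ≤ wnorm (wt ω) f :=
    tsum_nonneg fun s => mul_nonneg (norm_nonneg _) (wt_nonneg hω s)
  refine Real.sSup_le ?_ h0
  rintro r ⟨g, hg, hg1, rfl⟩
  exact (wnorm_conv_le hω hf hg).trans (mul_le_of_le_one_right h0 hg1)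
end

section
/- Let S be a right cancellative semigroup. Then the ℓ¹-norm on ℓ¹(S) is regular: for every f : S → ℂ with ‖f‖₁ := Σ_{s∈S} |f(s)| < ∞, one has sup{ ‖f * g‖₁ : g ∈ ℓ¹(S), ‖g‖₁ ≤ 1 } = ‖f‖₁. -/
section Convolution

variable {S : Type*} [Semigroup S]

open scoped Classical in
/-- Summing over the fibres of multiplication recovers the sum over all pairs. -/
theorem summable_mul_fiber {F : S × S → ℝ} (hF : Summable F) (hF0 : ∀ p, 0 ≤ F p) :
    Summable fun q : (S × S) × S => if q.1.1 * q.1.2 = q.2 then F q.1 else 0 := by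
  rw [summable_prod_of_nonneg (fun q => by dsimp only; split_ifs <;> simp [hF0])]
  refine ⟨fun p => (hasSum_ite_eq' (p.1 * p.2) (F p)).summable, ?_⟩
  simpa [tsum_ite_eq'] using hF

/-- The convolution of summable functions is summable, and the `ℓ¹`-norm is submultiplicative. -/
theorem summable_norm_conv_and_tsum_le {f g : S → ℂ} (hf : Summable fun s => ‖f s‖)
    (hg : Summable fun s => ‖g s‖) :
    (Summable fun s => ‖conv f g s‖) ∧
      ∑' s, ‖conv f g s‖ ≤ (∑' s, ‖f s‖) * ∑' s, ‖g s‖ := by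
  classical
  have hF : Summable fun p : S × S => ‖f p.1‖ * ‖g p.2‖ :=
    hf.mul_of_nonneg hg (fun _ => norm_nonneg _) (fun _ => norm_nonneg _)
  have hG := summable_mul_fiber hF (fun _ => by positivity)
  have hG' := hG.prod_symm
  have hnorm : ∀ s (p : S × S), ‖if p.1 * p.2 = s then f p.1 * g p.2 else 0‖ =
      if p.1 * p.2 = s then ‖f p.1‖ * ‖g p.2‖ else 0 := by
    intro s p
    split_ifs <;> simp
  have hle : ∀ s, ‖conv f g s‖ ≤
      ∑' p : S × S, if p.1 * p.2 = s then ‖f p.1‖ * ‖g p.2‖ else 0 := by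
    intro s
    simp only [← hnorm]
    refine norm_tsum_le_tsum_norm ?_
    simp only [hnorm]
    exact hG'.prod_factor s
  have hsum : Summable fun s => ‖conv f g s‖ :=
    hG'.prod.of_nonneg_of_le (fun _ => norm_nonneg _) hle
  refine ⟨hsum, (hsum.tsum_le_tsum hle hG'.prod).trans_eq ?_⟩
  have hcomm := Summable.tsum_comm
    (f := fun (p : S × S) (s : S) => if p.1 * p.2 = s then ‖f p.1‖ * ‖g p.2‖ else 0) hG
  rw [hcomm, hf.tsum_mul_tsum hg hF]
  simp [tsum_ite_eq']

open scoped Classical in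
/-- Convolving with a point mass at `s` translates by `s`. -/
theorem conv_single_apply_mul (hS : RightCancellative S) (f : S → ℂ) (s t : S) :
    conv f (Pi.single s 1) (t * s) = f t := by
  rw [conv, tsum_eq_single (t, s)]
  · simp
  · rintro ⟨u, v⟩ huv
    split_ifs with h
    · by_cases hv : v = s
      · subst hv
        exact absurd (by rw [hS u t v h]) huv
      · simp [hv]
    · rfl

end Convolution

theorem stmt11 {S : Type*} [Semigroup S] (hS : RightCancellative S) :
    ∀ f : S → ℂ, (Summable fun s => ‖f s‖) →
      opW (fun _ => (1 : ℝ)) f = wnorm (fun _ => (1 : ℝ)) f := by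
  classical
  intro f hf
  simp only [opW, wnorm, mul_one]
  have hub : ∀ r ∈ {r : ℝ | ∃ g : S → ℂ,
      (Summable fun s => ‖g s‖) ∧ ∑' s, ‖g s‖ ≤ 1 ∧ r = ∑' s, ‖conv f g s‖},
      r ≤ ∑' s, ‖f s‖ := by
    rintro r ⟨g, hg, hg1, rfl⟩
    exact (summable_norm_conv_and_tsum_le hf hg).2.trans
      (mul_le_of_le_one_right (tsum_nonneg fun _ => norm_nonneg _) hg1)
  refine le_antisymm (csSup_le ⟨_, 0, by simp, by simp, rfl⟩ hub) ?_
  rcases isEmpty_or_nonempty S with hE | ⟨⟨s⟩⟩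
  · refine le_csSup ⟨_, hub⟩ ⟨0, by simp, by simp, by simp⟩
  · have hnorm : (fun t => ‖(Pi.single s 1 : S → ℂ) t‖) = fun t => if t = s then (1 : ℝ) else 0 := by
      funext t
      by_cases h : t = s <;> simp [h]
    have hδ : HasSum (fun t => ‖(Pi.single s 1 : S → ℂ) t‖) 1 := hnorm ▸ hasSum_ite_eq s 1
    refine le_trans ?_ (le_csSup ⟨_, hub⟩ ⟨Pi.single s 1, hδ.summable, hδ.tsum_eq.le, rfl⟩)
    have hinj : Function.Injective fun t : S => t * s := fun x y h => hS x y s h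
    simpa [Function.comp_def, conv_single_apply_mul hS] using
      tsum_comp_le_tsum_of_inj (summable_norm_conv_and_tsum_le hf hδ.summable).1
        (fun _ => norm_nonneg _) hinj
end
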